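/- Let (p_i)_{i≥1} be a Kakeya sequence, i.e., a sequence of positive real numbers such that p_i → 0 and p_n ≤ Σ_{i=n+1}^∞ p_i for all n ≥ 1 (in particular the series Σ p_i converges or diverges to +∞; assume here it converges with sum S). Then a real number x admits a representation x = Σ_{i=1}^∞ c_i p_i with some sequence (c_i) ∈ {0,1}^ℕ if and only if x ∈ [0, S]. -/

import Mathlib

/-- The remainder of the greedy expansion of `x` along `q` after `n` digits. -/
noncomputable def greedyRemainder (q : ℕ → ℝ) (x : ℝ) : ℕ → ℝ
  | 0 => x
  | n + 1 => if q n ≤ greedyRemainder q x n then greedyRemainder q x n - q n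
      else greedyRemainder q x n

/-- The digits of the greedy expansion of `x` along `q`. -/
noncomputable def greedyDigit (q : ℕ → ℝ) (x : ℝ) (n : ℕ) : Fin 2 :=
  if q n ≤ greedyRemainder q x n then 1 else 0

lemma sum_greedyDigit (q : ℕ → ℝ) (x : ℝ) (n : ℕ) :
    ∑ i ∈ Finset.range n, ((greedyDigit q x i : ℕ) : ℝ) * q i = x - greedyRemainder q x n := by
  induction n with
  | zero => simp [greedyRemainder]
  | succ n ih =>
    rw [Finset.sum_range_succ, ih]
    by_cases h : q n ≤ greedyRemainder q x n
    · simp [greedyDigit, greedyRemainder, h]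
      ring
    · simp [greedyDigit, greedyRemainder, h]

lemma greedyRemainder_mem_Icc {q : ℕ → ℝ} (hq : Summable q)
    (hkak : ∀ n, q n ≤ ∑' i, q (i + (n + 1))) {x : ℝ} (hx : x ∈ Set.Icc 0 (∑' i, q i)) (n : ℕ) :
    greedyRemainder q x n ∈ Set.Icc 0 (∑' i, q (i + n)) := by
  induction n with
  | zero => simpa [greedyRemainder] using hx
  | succ n ih =>
    have hsplit : ∑' i, q (i + n) = q n + ∑' i, q (i + (n + 1)) := by
      rw [((summable_nat_add_iff n).2 hq).tsum_eq_zero_add]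
      simp [add_assoc, add_comm 1 n]
    obtain ⟨h0, h1⟩ := ih
    have := hkak n
    rw [greedyRemainder]
    split_ifs with h <;> constructor <;> linarith

lemma hasSum_greedyDigit {q : ℕ → ℝ} (hpos : ∀ n, 0 ≤ q n) (hq : Summable q)
    (hkak : ∀ n, q n ≤ ∑' i, q (i + (n + 1))) {x : ℝ} (hx : x ∈ Set.Icc 0 (∑' i, q i)) :
    HasSum (fun i => ((greedyDigit q x i : ℕ) : ℝ) * q i) x := by
  rw [hasSum_iff_tendsto_nat_of_nonneg (fun i => mul_nonneg (Nat.cast_nonneg _) (hpos i))]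
  simp only [sum_greedyDigit]
  have hr : Filter.Tendsto (greedyRemainder q x) Filter.atTop (nhds 0) :=
    squeeze_zero (fun n => (greedyRemainder_mem_Icc hq hkak hx n).1)
      (fun n => (greedyRemainder_mem_Icc hq hkak hx n).2) (tendsto_sum_nat_add q)
  simpa using hr.const_sub x

/-- **Kakeya's theorem.** If `(p_i)_{i ≥ 1}` is a Kakeya sequence (positive terms,
`p_i → 0`, and `p_n ≤ Σ_{i=n+1}^∞ p_i` for all `n ≥ 1`), with convergent sum `S`,
then `x` has an expansion `x = Σ c_i p_i` with digits `c_i ∈ {0,1}` iff `x ∈ [0, S]`. -/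
theorem stmt_0 (p : ℕ → ℝ) (S : ℝ)
    (hpos : ∀ i, 1 ≤ i → 0 < p i)
    (hlim : Filter.Tendsto p Filter.atTop (nhds 0))
    (hsum : Summable (fun i => p (i + 1)))
    (hkak : ∀ n, 1 ≤ n → p n ≤ ∑' i : ℕ, p (n + 1 + i))
    (hS : S = ∑' i : ℕ, p (i + 1)) (x : ℝ) :
    (∃ c : ℕ → Fin 2, x = ∑' i : ℕ, ((c i : ℕ) : ℝ) * p (i + 1)) ↔
      x ∈ Set.Icc 0 S := by
  have hq : ∀ i, 0 ≤ p (i + 1) := fun i => (hpos (i + 1) (by lia)).le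
  subst hS
  constructor
  · rintro ⟨c, rfl⟩
    have hnonneg : ∀ i, 0 ≤ ((c i : ℕ) : ℝ) * p (i + 1) := fun i =>
      mul_nonneg (Nat.cast_nonneg _) (hq i)
    have hle : ∀ i, ((c i : ℕ) : ℝ) * p (i + 1) ≤ p (i + 1) := fun i =>
      mul_le_of_le_one_left (hq i) (by exact_mod_cast Nat.le_of_lt_succ (c i).isLt)
    exact ⟨tsum_nonneg hnonneg,
      (Summable.of_nonneg_of_le hnonneg hle hsum).tsum_le_tsum hle hsum⟩
  · intro hx
    refine ⟨greedyDigit (fun i => p (i + 1)) x,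
      (hasSum_greedyDigit hq hsum (fun n => ?_) hx).tsum_eq.symm⟩
    convert hkak (n + 1) (by lia) using 4 with i
    ring
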